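/- Every double-critical 6-chromatic graph with minimum degree at most 7 contains a subdivision of the complete graph on 6 vertices. -/

import Mathlib

/-- A connected graph `G` with chromatic number `k` is *double-critical* if for every
edge `uv` of `G`, deleting both `u` and `v` yields a graph that is `(k-2)`-colourable. -/
def SimpleGraph.DoubleCritical {V : Type*} (G : SimpleGraph V) (k : ℕ) : Prop :=
  G.Connected ∧ G.chromaticNumber = k ∧
    ∀ u v : V, G.Adj u v →
      (G.induce ({u, v}ᶜ : Set V)).chromaticNumber ≤ (k - 2 : ℕ)

/-- `G` contains a subdivision of `K₆`: there are six distinct branch vertices and,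
for each pair of branch vertices, a path of `G` between them, such that these paths
are pairwise internally vertex-disjoint and no path passes through a branch vertex
other than its two endpoints. -/
def ContainsK6Subdivision {V : Type*} (G : SimpleGraph V) : Prop :=
  ∃ (b : Fin 6 ↪ V) (P : ∀ i j : Fin 6, i < j → G.Walk (b i) (b j)),
    (∀ i j h, (P i j h).IsPath) ∧
    (∀ i j h k, b k ∈ (P i j h).support → k = i ∨ k = j) ∧
    (∀ i j h i' j' h', (i, j) ≠ (i', j') →
      ∀ v, v ∈ (P i j h).support → v ∈ (P i' j' h').support → ∃ k, v = b k)

open SimpleGraph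

lemma k6_of_labels {V : Type*} (G : SimpleGraph V) (b : Fin 6 → V) (hb : Function.Injective b)
    (lab : V → Fin 6 × Fin 6)
    (h : ∀ i j : Fin 6, i < j → ∃ p : G.Walk (b i) (b j), ∀ v ∈ p.support,
      v = b i ∨ v = b j ∨ ((∀ k, v ≠ b k) ∧ lab v = (i, j))) :
    ContainsK6Subdivision G := by
  classical
  choose P hP using h
  refine ⟨⟨b, hb⟩, fun i j h => (P i j h).bypass, ?_, ?_, ?_⟩
  · intro i j h
    exact (P i j h).bypass_isPath
  · intro i j h k hk
    rcases hP i j h _ ((P i j h).support_bypass_subset_support hk) with h1 | h1 | h1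
    · exact Or.inl (hb h1)
    · exact Or.inr (hb h1)
    · exact absurd rfl (h1.1 k)
  · intro i j h i' j' h' hne v hv hv'
    rcases hP i j h _ ((P i j h).support_bypass_subset_support hv) with h1 | h1 | h1
    · exact ⟨_, h1⟩
    · exact ⟨_, h1⟩
    · rcases hP i' j' h' _ ((P i' j' h').support_bypass_subset_support hv') with h2 | h2 | h2
      · exact ⟨_, h2⟩
      · exact ⟨_, h2⟩
      · exact absurd (h1.2.symm.trans h2.2) hne

/-- A pair of branch vertices is fine when adjacent, joined by a private vertex, or joined by a
walk. -/
lemma k6_of_cases {V : Type*} (G : SimpleGraph V) (b : Fin 6 → V) (hb : Function.Injective b)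
    (lab : V → Fin 6 × Fin 6)
    (h : ∀ i j : Fin 6, i < j → G.Adj (b i) (b j) ∨
      (∃ m, G.Adj (b i) m ∧ G.Adj m (b j) ∧ (∀ k, m ≠ b k) ∧ lab m = (i, j)) ∨
      ∃ p : G.Walk (b i) (b j), ∀ v ∈ p.support,
      v = b i ∨ v = b j ∨ ((∀ k, v ≠ b k) ∧ lab v = (i, j))) :
    ContainsK6Subdivision G := by
  refine k6_of_labels G b hb lab fun i j hij => ?_
  rcases h i j hij with h | ⟨m, h1, h2, h3⟩ | h
  · exact ⟨Walk.cons h Walk.nil, by simp⟩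
  · refine ⟨Walk.cons h1 (Walk.cons h2 Walk.nil), ?_⟩
    intro v hv
    simp at hv
    rcases hv with rfl | rfl | rfl
    · exact Or.inl rfl
    · exact Or.inr (Or.inr h3)
    · exact Or.inr (Or.inl rfl)
  · exact h

lemma k6_of_clique {V : Type*} (G : SimpleGraph V) (x : V) (s : Finset V) (hs : 5 ≤ s.card)
    (hx : ∀ v ∈ s, G.Adj x v) (h : ∀ v ∈ s, ∀ w ∈ s, v ≠ w → G.Adj v w) :
    ContainsK6Subdivision G := by
  classical
  have hxs : x ∉ s := fun hh => G.loopless.irrefl x (hx x hh)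
  have hc : Fintype.card (Fin 6) ≤ (insert x s).card := by
    rw [Finset.card_insert_of_notMem hxs]; simp; omega
  have hc' : Fintype.card (Fin 6) ≤ Fintype.card (insert x s : Finset V) := by simpa using hc
  obtain ⟨e⟩ := Function.Embedding.nonempty_of_card_le hc'
  have hinj : Function.Injective (fun i => (e i : V)) := fun i j hij =>
    e.injective (Subtype.ext hij)
  refine k6_of_cases G (fun i => (e i : V)) hinj (fun _ => (0, 0)) ?_
  intro i j hij
  left
  have hne : (e i : V) ≠ e j := fun hh => hij.ne (hinj hh)
  have h1 := (e i).2
  have h2 := (e j).2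
  rw [Finset.mem_insert] at h1 h2
  rcases h1 with h1 | h1 <;> rcases h2 with h2 | h2
  · exact absurd (h1.trans h2.symm) hne
  · show G.Adj (e i : V) (e j)
    rw [h1]; exact hx _ h2
  · show G.Adj (e i : V) (e j)
    rw [h2]; exact (hx _ h1).symm
  · exact h _ h1 _ h2 hne

/-- `K₃ ∨ C₅`. -/
lemma k6_case5 {V : Type*} (G : SimpleGraph V) (x r s c0 c1 c2 c3 c4 : V)
    (hnd : [x, r, s, c0, c1, c2, c3, c4].Nodup)
    (hx : ∀ v ∈ [r, s, c0, c1, c2, c3, c4], G.Adj x v)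
    (hr : ∀ v ∈ [s, c0, c1, c2, c3, c4], G.Adj r v)
    (hs : ∀ v ∈ [c0, c1, c2, c3, c4], G.Adj s v)
    (h01 : G.Adj c0 c1) (h12 : G.Adj c1 c2) (h23 : G.Adj c2 c3) (h34 : G.Adj c3 c4)
    (h40 : G.Adj c4 c0) : ContainsK6Subdivision G := by
  classical
  simp at hnd hx hr hs
  refine k6_of_cases G ![x, r, s, c0, c1, c3] ?_
    (fun v => if v = c2 then (4, 5) else (3, 5)) ?_
  · intro i j hij
    fin_cases i <;> fin_cases j <;> simp at hij ⊢ <;> grind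
  · have e1 : ∀ k, c2 ≠ (![x, r, s, c0, c1, c3] : Fin 6 → V) k := by
      intro k; fin_cases k <;> simp <;> grind
    have e2 : ∀ k, c4 ≠ (![x, r, s, c0, c1, c3] : Fin 6 → V) k := by
      intro k; fin_cases k <;> simp <;> grind
    have e3 : c4 ≠ c2 := by grind
    intro i j hij
    by_cases h45 : i = 4 ∧ j = 5
    · obtain ⟨rfl, rfl⟩ := h45
      exact Or.inr (Or.inl ⟨c2, h12, h23, e1, by simp⟩)
    by_cases h35 : i = 3 ∧ j = 5
    · obtain ⟨rfl, rfl⟩ := h35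
      exact Or.inr (Or.inl ⟨c4, h40.symm, h34.symm, e2, by simp [e3]⟩)
    left
    fin_cases i <;> fin_cases j <;> simp at hij h45 h35 ⊢ <;> grind

/-- `K₂` joined to a prism with triangles `a0 a1 a2` and `b0 b1 b2`. -/
lemma k6_case6 {V : Type*} (G : SimpleGraph V) (x s a0 a1 a2 b0 b1 b2 : V)
    (hnd : [x, s, a0, a1, a2, b0, b1, b2].Nodup)
    (hx : ∀ v ∈ [s, a0, a1, a2, b0, b1, b2], G.Adj x v)
    (hs : ∀ v ∈ [a0, a1, a2, b0, b1, b2], G.Adj s v)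
    (h01 : G.Adj a0 a1) (h02 : G.Adj a0 a2) (h12 : G.Adj a1 a2)
    (k01 : G.Adj b0 b1) (k02 : G.Adj b0 b2)
    (m0 : G.Adj a0 b0) (m1 : G.Adj a1 b1) (m2 : G.Adj a2 b2) : ContainsK6Subdivision G := by
  classical
  simp at hnd hx hs
  refine k6_of_cases G ![x, s, a0, a1, a2, b0] ?_
    (fun v => if v = b1 then (3, 5) else (4, 5)) ?_
  · intro i j hij
    fin_cases i <;> fin_cases j <;> simp at hij ⊢ <;> grind
  · have e1 : ∀ k, b1 ≠ (![x, s, a0, a1, a2, b0] : Fin 6 → V) k := by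
      intro k; fin_cases k <;> simp <;> grind
    have e2 : ∀ k, b2 ≠ (![x, s, a0, a1, a2, b0] : Fin 6 → V) k := by
      intro k; fin_cases k <;> simp <;> grind
    have e3 : b2 ≠ b1 := by grind
    intro i j hij
    by_cases h45 : i = 3 ∧ j = 5
    · obtain ⟨rfl, rfl⟩ := h45
      exact Or.inr (Or.inl ⟨b1, m1, k01.symm, e1, by simp⟩)
    by_cases h35 : i = 4 ∧ j = 5
    · obtain ⟨rfl, rfl⟩ := h35
      exact Or.inr (Or.inl ⟨b2, m2, k02.symm, e2, by simp [e3]⟩)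
    left
    fin_cases i <;> fin_cases j <;> simp at hij h45 h35 ⊢ <;> grind

/-- `K₁` joined to the complement of a 7-cycle, with an outside path from `v5` to `v6`. -/
lemma k6_case7 {V : Type*} (G : SimpleGraph V) (x v0 v1 v2 v3 v4 v5 v6 : V)
    (hnd : [x, v0, v1, v2, v3, v4, v5, v6].Nodup)
    (hx : ∀ v ∈ [v0, v1, v2, v3, v4, v5, v6], G.Adj x v)
    (h1 : ∀ v ∈ [v3, v4, v5, v6], G.Adj v1 v)
    (h3 : ∀ v ∈ [v0, v5, v6], G.Adj v3 v)
    (h4 : ∀ v ∈ [v0, v2, v6], G.Adj v4 v)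
    (h52 : G.Adj v5 v2)
    (p : G.Walk v5 v6)
    (hp : ∀ v ∈ p.support, v = v5 ∨ v = v6 ∨ v ≠ x ∧ ¬ G.Adj x v) : ContainsK6Subdivision G := by
  classical
  simp at hnd hx h1 h3 h4
  refine k6_of_cases G ![x, v1, v3, v4, v5, v6] ?_
    (fun v => if v = v0 then (2, 3) else if v = v2 then (3, 4) else (4, 5)) ?_
  · intro i j hij
    fin_cases i <;> fin_cases j <;> simp at hij ⊢ <;> grind
  · have e1 : ∀ k, v0 ≠ (![x, v1, v3, v4, v5, v6] : Fin 6 → V) k := by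
      intro k; fin_cases k <;> simp <;> grind
    have e2 : ∀ k, v2 ≠ (![x, v1, v3, v4, v5, v6] : Fin 6 → V) k := by
      intro k; fin_cases k <;> simp <;> grind
    have e3 : v2 ≠ v0 := by grind
    intro i j hij
    by_cases h23 : i = 2 ∧ j = 3
    · obtain ⟨rfl, rfl⟩ := h23
      exact Or.inr (Or.inl ⟨v0, h3.1, h4.1.symm, e1, by simp⟩)
    by_cases h34 : i = 3 ∧ j = 4
    · obtain ⟨rfl, rfl⟩ := h34
      exact Or.inr (Or.inl ⟨v2, h4.2.1, h52.symm, e2, by simp [e3]⟩)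
    by_cases h45 : i = 4 ∧ j = 5
    · obtain ⟨rfl, rfl⟩ := h45
      refine Or.inr (Or.inr ⟨p, fun v hv => ?_⟩)
      rcases hp v hv with h | h | ⟨h, h'⟩
      · exact Or.inl h
      · exact Or.inr (Or.inl h)
      · refine Or.inr (Or.inr ⟨?_, ?_⟩)
        · intro k; fin_cases k <;> simp <;> grind
        · have : v ≠ v0 := by grind
          have : v ≠ v2 := by grind
          simp [*]
    left
    fin_cases i <;> fin_cases j <;> simp at hij h23 h34 h45 ⊢ <;> grind [SimpleGraph.adj_comm]

/-- Every colour class of a 4-colouring of `G - x - y` contains a common neighbour. -/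
lemma common_nbr {V : Type*} (G : SimpleGraph V) (h5 : ¬ G.Colorable 5) (x y : V)
    (f : V → Fin 4)
    (hf : ∀ a b, a ≠ x → a ≠ y → b ≠ x → b ≠ y → G.Adj a b → f a ≠ f b) (c : Fin 4) :
    ∃ w, G.Adj x w ∧ G.Adj y w ∧ f w = c := by
  classical
  by_contra hcon
  push Not at hcon
  apply h5
  -- class `c` is split between the new colour `4` (with `y`) and `c` (with `x`)
  let g : V → Fin 5 := fun v =>
    if v = x then c.castSucc else if v = y then 4 else
      if f v = c then (if G.Adj x v then 4 else c.castSucc) else (f v).castSucc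
  have key : ∀ d : Fin 4, d.castSucc ≠ (4 : Fin 5) := by decide
  refine ⟨Coloring.mk g ?_⟩
  intro a b hab
  have hne := hab.ne
  have hfab := hf a b
  have ha := hcon a
  have hb := hcon b
  have hab' := hab.symm
  have kc := key c
  have kc' := fun d => (key d).symm
  have inj : ∀ d e : Fin 4, d.castSucc = e.castSucc → d = e := fun d e h =>
    Fin.castSucc_injective _ h
  simp only [g]
  split_ifs <;> grind

/-- Gluing along a clique. -/
lemma clique_glue {V : Type*} (G : SimpleGraph V) (h5 : ¬ G.Colorable 5)
    (D A : Set V) (x u : V) (hu : u ∈ D) (hxD : x ∉ D) (hxA : x ∉ A) (hAD : ∀ a ∈ A, a ∉ D)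
    (hA : ∀ d ∈ D, ∀ w, w ∉ D → G.Adj d w → w ∈ A)
    (hcl : ∀ a ∈ A, ∀ b ∈ A, a ≠ b → G.Adj a b)
    (f1 f2 : V → Fin 5)
    (hf1 : ∀ a b, a ≠ x → b ≠ x → G.Adj a b → f1 a ≠ f1 b)
    (hf2 : ∀ a b, a ≠ u → b ≠ u → G.Adj a b → f2 a ≠ f2 b) : False := by
  classical
  have i1 : Set.InjOn f1 A := fun a ha b hb hab => by
    by_contra hne
    exact hf1 a b (fun h => hxA (h ▸ ha)) (fun h => hxA (h ▸ hb)) (hcl a ha b hb hne) hab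
  have huA : u ∉ A := fun h => hAD u h hu
  have i2 : Set.InjOn f2 A := fun a ha b hb hab => by
    by_contra hne
    exact hf2 a b (fun h => huA (h ▸ ha)) (fun h => huA (h ▸ hb)) (hcl a ha b hb hne) hab
  obtain ⟨σ, hσ⟩ : ∃ σ : Equiv.Perm (Fin 5), ∀ a ∈ A, σ (f1 a) = f2 a := by
    let e1 := Equiv.Set.imageOfInjOn f1 A i1
    let e2 := Equiv.Set.imageOfInjOn f2 A i2
    let e : {c // c ∈ f1 '' A} ≃ {c // c ∈ f2 '' A} := e1.symm.trans e2
    refine ⟨e.extendSubtype, fun a ha => ?_⟩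
    rw [Equiv.extendSubtype_apply_of_mem e _ ⟨a, ha, rfl⟩]
    have : e1 ⟨a, ha⟩ = ⟨f1 a, ⟨a, ha, rfl⟩⟩ := rfl
    show (e2 (e1.symm ⟨f1 a, _⟩) : Fin 5) = _
    rw [← this, Equiv.symm_apply_apply]
    rfl
  apply h5
  refine ⟨Coloring.mk (fun v => if v ∈ D then σ (f1 v) else f2 v) ?_⟩
  intro a b hab
  by_cases ha : a ∈ D <;> by_cases hb : b ∈ D <;> simp only [ha, hb, if_true, if_false]
  · intro h
    exact hf1 a b (fun h => hxD (h ▸ ha)) (fun h => hxD (h ▸ hb)) hab (σ.injective h)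
  · have hbA := hA a ha b hb hab
    rw [← hσ b hbA]
    intro h
    exact hf1 a b (fun h => hxD (h ▸ ha)) (fun h => hxA (h ▸ hbA)) hab (σ.injective h)
  · have haA := hA b hb a ha hab.symm
    rw [← hσ a haA]
    intro h
    exact hf1 a b (fun h => hxA (h ▸ haA)) (fun h => hxD (h ▸ hb)) hab (σ.injective h)
  · exact hf2 a b (fun h => ha (h ▸ hu)) (fun h => hb (h ▸ hu)) hab

/-- If some vertex lies outside `N[x]`, two nonadjacent neighbours of `x` are joined outside. -/
lemma outside_path {V : Type*} (G : SimpleGraph V) (h5 : ¬ G.Colorable 5)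
    (hv : ∀ v, ∃ f : V → Fin 5, ∀ a b, a ≠ v → b ≠ v → G.Adj a b → f a ≠ f b)
    (x u : V) (hux : u ≠ x) (hu : ¬ G.Adj x u) :
    ∃ a b, G.Adj x a ∧ G.Adj x b ∧ a ≠ b ∧ ¬ G.Adj a b ∧ ∃ p : G.Walk a b,
      ∀ v ∈ p.support, v = a ∨ v = b ∨ v ≠ x ∧ ¬ G.Adj x v := by
  classical
  by_contra hcon
  let D : Set V := {w | ∃ p : G.Walk u w, ∀ z ∈ p.support, z ≠ x ∧ ¬ G.Adj x z}
  have hD : ∀ d ∈ D, d ≠ x ∧ ¬ G.Adj x d := fun d ⟨p, hp⟩ => hp d p.end_mem_support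
  have hDout : ∀ d ∈ D, ∀ w, w ∉ D → G.Adj d w → G.Adj x w := by
    rintro d hd w hw hdw
    by_contra hxw
    have hwx : w ≠ x := by
      rintro rfl
      exact (hD d hd).2 hdw.symm
    obtain ⟨p, hp⟩ := hd
    apply hw
    refine ⟨p.concat hdw, fun z hz => ?_⟩
    rw [Walk.support_concat] at hz
    simp at hz
    rcases hz with hz | rfl
    · exact hp z hz
    · exact ⟨hwx, hxw⟩
  obtain ⟨f1, hf1⟩ := hv x
  obtain ⟨f2, hf2⟩ := hv u
  refine clique_glue G h5 D {w | w ∉ D ∧ ∃ d ∈ D, G.Adj d w} x u ?_ ?_ ?_ ?_ ?_ ?_ f1 f2 hf1 hf2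
  · exact ⟨Walk.nil, by simp [hux, hu]⟩
  · exact fun h => (hD x h).1 rfl
  · rintro ⟨h, d, hd, hdx⟩
    exact (hD d hd).2 hdx.symm
  · exact fun a ha => ha.1
  · exact fun d hd w hw hdw => ⟨hw, d, hd, hdw⟩
  · rintro a ⟨haD, d, hd, hda⟩ b ⟨hbD, e, he, heb⟩ hne
    by_contra hab
    apply hcon
    refine ⟨a, b, hDout d hd a haD hda, hDout e he b hbD heb, hne, hab, ?_⟩
    obtain ⟨p, hp⟩ := hd
    obtain ⟨q, hq⟩ := he
    refine ⟨Walk.cons hda.symm ((p.reverse.append q).concat heb), fun z hz => ?_⟩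
    rw [Walk.support_cons, Walk.support_concat] at hz
    simp [Walk.mem_support_append_iff] at hz
    rcases hz with rfl | (hz | hz) | rfl
    · exact Or.inl rfl
    · exact Or.inr (Or.inr (hp z hz))
    · exact Or.inr (Or.inr (hq z hz))
    · exact Or.inr (Or.inl rfl)

set_option maxHeartbeats 2000000 in
/-- Every double-critical 6-chromatic graph with minimum degree at most 7 contains a
subdivision of `K₆`. -/
theorem double_critical_six_chromatic_minDegree_le_seven_containsK6Subdivision
    {V : Type*} [Fintype V] (G : SimpleGraph V) [DecidableRel G.Adj]
    (hG : G.DoubleCritical 6) (hδ : G.minDegree ≤ 7) :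
    ContainsK6Subdivision G := by
  classical
  obtain ⟨hconn, hchi, hdc⟩ := hG
  have h5 : ¬ G.Colorable 5 := by
    intro h
    have := h.chromaticNumber_le
    rw [hchi] at this
    exact absurd (by exact_mod_cast this : (6 : ℕ) ≤ 5) (by norm_num)
  have h4 : ∀ x y, G.Adj x y → ∃ f : V → Fin 4,
      ∀ a b, a ≠ x → a ≠ y → b ≠ x → b ≠ y → G.Adj a b → f a ≠ f b := by
    intro x y hxy
    obtain ⟨C⟩ : (G.induce ({x, y}ᶜ : Set V)).Colorable 4 :=
      chromaticNumber_le_iff_colorable.1 (hdc x y hxy)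
    refine ⟨fun v => if h : v ∈ ({x, y}ᶜ : Set V) then C ⟨v, h⟩ else 0, ?_⟩
    intro a b h1 h2 h3 h4 hab
    have ha : a ∈ ({x, y}ᶜ : Set V) := by simp [h1, h2]
    have hb : b ∈ ({x, y}ᶜ : Set V) := by simp [h3, h4]
    simp only [ha, hb, dif_pos]
    exact C.valid (v := ⟨a, ha⟩) (w := ⟨b, hb⟩) hab
  have : Nonempty V := hconn.nonempty
  have hnt : Nontrivial V := by
    by_contra hnt
    rw [not_nontrivial_iff_subsingleton] at hnt
    exact h5 ⟨Coloring.mk (fun _ => 0) (fun {a b} hab => absurd (Subsingleton.elim a b) hab.ne)⟩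
  have hnb : ∀ v, ∃ w, G.Adj v w := fun v => hconn.preconnected.exists_adj_of_nontrivial v
  have hv5 : ∀ v, ∃ f : V → Fin 5, ∀ a b, a ≠ v → b ≠ v → G.Adj a b → f a ≠ f b := by
    intro v
    obtain ⟨w, hvw⟩ := hnb v
    obtain ⟨f, hf⟩ := h4 v w hvw
    refine ⟨fun z => if z = w then 4 else (f z).castSucc, ?_⟩
    intro a b ha hb hab
    have key : ∀ d : Fin 4, d.castSucc ≠ (4 : Fin 5) := by decide
    have := hab.ne
    by_cases haw : a = w <;> by_cases hbw : b = w <;> simp only [haw, hbw, if_true, if_false]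
    · exact absurd (haw.trans hbw.symm) this
    · exact (key _).symm
    · exact key _
    · exact fun h => hf a b ha haw hb hbw hab (Fin.castSucc_injective _ h)
  obtain ⟨x, hxd⟩ := G.exists_minimal_degree_vertex
  obtain ⟨N, hN⟩ : ∃ N, N = G.neighborFinset x := ⟨_, rfl⟩
  have hNmem : ∀ v, v ∈ N ↔ G.Adj x v := fun v => by simp [hN]
  have hNcard : N.card = G.minDegree := by rw [hxd]; simp [hN]
  clear hN
  -- each neighbour has at least four neighbours inside `N`
  have hcom : ∀ z ∈ N, 4 ≤ (N.filter (fun w => G.Adj z w)).card := by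
    intro z hz
    obtain ⟨f, hf⟩ := h4 x z ((hNmem z).1 hz)
    have : (Finset.univ : Finset (Fin 4)) ⊆ (N.filter (fun w => G.Adj z w)).image f := by
      intro c _
      obtain ⟨w, h1, h2, h3⟩ := common_nbr G h5 x z f hf c
      simp only [Finset.mem_image, Finset.mem_filter]
      exact ⟨w, ⟨(hNmem w).2 h1, h2⟩, h3⟩
    have h := (Finset.card_le_card this).trans Finset.card_image_le
    simpa using h
  have F2 : ∀ y ∈ N, ∀ z ∈ N, y ≠ z → ¬ G.Adj y z →
      ∃ a ∈ N, a ≠ y ∧ ¬ G.Adj y a ∧ G.Adj z a := by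
    intro y hy z hz hne hyz
    obtain ⟨f, hf⟩ := h4 x z ((hNmem z).1 hz)
    obtain ⟨w, h1, h2, h3⟩ := common_nbr G h5 x z f hf (f y)
    refine ⟨w, (hNmem w).2 h1, ?_, ?_, h2⟩
    · rintro rfl; exact hyz h2.symm
    · intro h
      exact hf y w ((hNmem y).1 hy).ne' hne h1.ne' h2.ne' h h3.symm
  have hsplit : ∀ z ∈ N, (N.filter (fun w => ¬ G.Adj z w)).card + 4 ≤ N.card := by
    intro z hz
    have h1 := Finset.card_filter_add_card_filter_not (s := N) (fun w => G.Adj z w)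
    have h2 := hcom z hz
    omega
  have hN5 : 5 ≤ N.card := by
    obtain ⟨w, hw⟩ := hnb x
    have hw' := (hNmem w).2 hw
    have := hsplit w hw'
    have : 0 < (N.filter (fun v => ¬ G.Adj w v)).card :=
      Finset.card_pos.2 ⟨w, by simp [hw']⟩
    omega
  by_cases hclq : ∀ v ∈ N, ∀ w ∈ N, v ≠ w → G.Adj v w
  · exact k6_of_clique G x N hN5 (fun v hv => (hNmem v).1 hv) hclq
  push Not at hclq
  obtain ⟨y, hy, z, hz, hyz, hnyz⟩ := hclq
  have hN7 : N.card = 7 := by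
    obtain ⟨a, ha, hay, hnya, hza⟩ := F2 y hy z hz hyz hnyz
    have h1 : ({y, z, a} : Finset V) ⊆ N.filter (fun w => ¬ G.Adj y w) := by
      intro t ht
      simp at ht
      rcases ht with rfl | rfl | rfl <;> exact Finset.mem_filter.2 ⟨‹_›, by first | assumption | simp⟩
    have h2 := Finset.card_le_card h1
    rw [Finset.card_eq_three.2 ⟨y, z, a, hyz, hay.symm, hza.ne, rfl⟩] at h2
    have := hsplit y hy
    omega
  have F1 : ∀ z ∈ N, ∀ a ∈ N, ∀ b ∈ N, ∀ c ∈ N, z ≠ a → z ≠ b → z ≠ c → a ≠ b → a ≠ c → b ≠ c →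
      ¬ G.Adj z a → ¬ G.Adj z b → G.Adj z c := by
    intro z hz a ha b hb c hc za zb zc ab ac bc na nb
    by_contra nc
    have h1 : ({z, a, b, c} : Finset V) ⊆ N.filter (fun w => ¬ G.Adj z w) := by
      intro t ht
      simp at ht
      rcases ht with rfl | rfl | rfl | rfl <;> exact Finset.mem_filter.2 ⟨‹_›, by first | assumption | simp⟩
    have h2 := Finset.card_le_card h1
    have h3 : ({z, a, b, c} : Finset V).card = 4 := by
      rw [Finset.card_insert_of_notMem (by simp [*]), Finset.card_eq_three.2 ⟨a, b, c, ab, ac, bc, rfl⟩]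
    have := hsplit z hz
    omega
  have F3 : ∀ y ∈ N, ∀ z ∈ N, ∀ u ∈ N, y ≠ z → y ≠ u → z ≠ u →
      ¬ G.Adj y z → ¬ G.Adj y u → G.Adj z u := by
    intro y hy z hz u hu yz yu zu nyz nyu
    by_contra nzu
    obtain ⟨a, ha, hay, hnya, hza⟩ := F2 y hy z hz yz nyz
    exact hnya (F1 y hy z hz u hu a ha yz yu hay.symm zu hza.ne
      (by rintro rfl; exact nzu hza) nyz nyu)
  have F4 : ∀ z ∈ N, ∀ y ∈ N, ∀ u ∈ N, ∀ w ∈ N, z ≠ y → z ≠ u → z ≠ w → y ≠ u → y ≠ w → u ≠ w →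
      ¬ G.Adj z y → ¬ G.Adj z u → ¬ G.Adj w y → G.Adj w u := by
    intro z hz y hy u hu w hw zy zu zw yu yw uw nzy nzu nwy
    by_contra nwu
    obtain ⟨f, hf⟩ := h4 x z ((hNmem z).1 hz)
    have key : ∀ t ∈ N, z ≠ t → t ≠ w → ¬ G.Adj z t → ¬ G.Adj w t → f t = f w := by
      intro t ht zt tw nzt nwt
      obtain ⟨a, h1, h2, h3⟩ := common_nbr G h5 x z f hf (f t)
      have hat : a ≠ t := by rintro rfl; exact nzt h2
      have hta : ¬ G.Adj t a := fun h =>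
        hf t a ((hNmem t).1 ht).ne' zt.symm h1.ne' h2.ne' h h3.symm
      by_cases haw : a = w
      · rw [← haw, h3]
      · exact absurd (F1 t ht z hz w hw a ((hNmem a).2 h1) zt.symm tw hat.symm zw h2.ne
          (fun h => haw h.symm) (fun h => nzt h.symm) (fun h => nwt h.symm)) hta
    have e1 := key y hy zy yw nzy nwy
    have e2 := key u hu zu uw nzu nwu
    exact hf y u ((hNmem y).1 hy).ne' zy.symm ((hNmem u).1 hu).ne' zu.symm
      (F3 z hz y hy u hu zy zu yu nzy nzu) (e1.trans e2.symm)
  -- a vertex outside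
  obtain ⟨u, hux, hxu⟩ : ∃ u, u ≠ x ∧ ¬ G.Adj x u := by
    by_contra hcon
    push Not at hcon
    have h1 : (Finset.univ : Finset V) ⊆ insert x N := by
      intro t _
      by_cases htx : t = x
      · simp [htx]
      · simp [(hNmem t).2 (hcon t htx)]
    have h2 := (Finset.card_le_card h1).trans (Finset.card_insert_le _ _)
    have h3 : insert y (insert z (G.neighborFinset y)) ⊆ (Finset.univ : Finset V) :=
      Finset.subset_univ _
    have h4 := Finset.card_le_card h3
    rw [Finset.card_insert_of_notMem (by simp [hyz]), Finset.card_insert_of_notMem (by simp [hnyz]),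
      card_neighborFinset_eq_degree] at h4
    have := G.minDegree_le_degree y
    omega
  obtain ⟨a, b, hxa, hxb, hab, hnab, p, hp⟩ := outside_path G h5 hv5 x u hux hxu
  have ha := (hNmem a).2 hxa
  have hb := (hNmem b).2 hxb
  have hnba : ¬ G.Adj b a := fun h => hnab h.symm
  -- the nonneighbour path `d a b c e`
  obtain ⟨d, hd, hda, nad, hbd⟩ := F2 a ha b hb hab hnab
  obtain ⟨c, hc, hcb, nbc, hac⟩ := F2 b hb a ha hab.symm hnba
  obtain ⟨e, he, hec, nce, hbe⟩ := F2 c hc b hb hcb (fun h => nbc h.symm)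
  have hxN : x ∉ N := by simp [hNmem]
  have hae : a ≠ e := by rintro rfl; exact nce hac.symm
  have hdc' : d ≠ c := by rintro rfl; exact nad hac
  have hde : d ≠ e := by
    rintro rfl
    exact nce (F4 b hb a ha c hc d hd hab.symm hcb.symm hbd.ne hac.ne hda.symm hec.symm
      hnba nbc (fun h => nad h.symm)).symm
  have full : ∀ v ∈ N, ∀ p ∈ N, ∀ q ∈ N, v ≠ p → v ≠ q → p ≠ q → ¬ G.Adj v p → ¬ G.Adj v q →
      ∀ t ∈ N, t ≠ v → t ≠ p → t ≠ q → G.Adj v t ∧ G.Adj t v := by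
    intro v hv p hp q hq vp vq pq np nq t ht tv tp tq
    have := F1 v hv p hp q hq t ht vp vq tv.symm pq tp.symm tq.symm np nq
    exact ⟨this, this.symm⟩
  have hdx : ∀ t ∈ N, x ≠ t := by
    rintro t ht rfl
    exact hxN ht
  have hxadj : ∀ t ∈ N, G.Adj x t := fun t ht => (hNmem t).1 ht
  have hdb : d ≠ b := hbd.ne'
  have heb : e ≠ b := hbe.ne'
  have hca : c ≠ a := hac.ne'
  have fa := full a ha d hd b hb hda.symm hab hdb nad hnab
  have fb := full b hb a ha c hc hab.symm hcb.symm hca.symm hnba nbc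
  have fc := full c hc b hb e he hcb hec.symm heb.symm (fun h => nbc h.symm) nce
  have nda : ¬ G.Adj d a := fun h => nad h.symm
  have nec : ¬ G.Adj e c := fun h => nce h.symm
  have main : ∀ r s, r ∈ N → s ∈ N → r ≠ s → (r ≠ d ∧ r ≠ a ∧ r ≠ b ∧ r ≠ c ∧ r ≠ e) →
      (s ≠ d ∧ s ≠ a ∧ s ≠ b ∧ s ≠ c ∧ s ≠ e) →
      (∀ t, t ∈ N → t = d ∨ t = a ∨ t = b ∨ t = c ∨ t = e ∨ t = r ∨ t = s) →
      ¬ G.Adj d r → ContainsK6Subdivision G := by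
    intro r s hr hs hrs ⟨rd, ra, rb, rc, re⟩ ⟨sd, sa, sb, sc, se⟩ hmem ndr
    have fd := full d hd a ha r hr hda rd.symm ra.symm nda ndr
    obtain ⟨e', he', hee', nee', hce'⟩ := F2 e he c hc hec nec
    have hca' := hce'.ne'
    have he'' : e' = r ∨ e' = s := by
      rcases hmem e' he' with rfl | rfl | rfl | rfl | rfl | h | h
      · exact absurd (fd e he hde.symm hae.symm re.symm).2 nee'
      · exact absurd (fa e he hae.symm hde.symm heb).2 nee'
      · exact absurd hbe.symm nee'
      · exact absurd rfl hca'
      · exact absurd rfl hee'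
      · exact Or.inl h
      · exact Or.inr h
    rcases he'' with rfl | rfl
    · have fe := full e he c hc e' hr hec hee'.symm rc.symm nec nee'
      have fr := full e' hr d hd e he rd re hde (fun h => ndr h.symm) (fun h => nee' h.symm)
      refine k6_case6 G x s d b e c e' a ?_ ?_ ?_ ?_ ?_ ?_ ?_ ?_ ?_ ?_ ?_
      all_goals clear hmem full F1 F2 F3 F4 hcom hsplit h4 hv5 hnb hdc hNmem hp p h5 hδ hchi hN7 hN5 hNcard hxd
      · simp; grind
      · simp; grind
      · simp; grind
      all_goals grind
    · have fe := full e he c hc e' hs hec hee'.symm sc.symm nec nee'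
      obtain ⟨r', hr', hrr', nrr', hdr'⟩ := F2 r hr d hd rd (fun h => ndr h.symm)
      have hdr'' := hdr'.ne'
      have hr'' : r' = e' := by
        rcases hmem r' hr' with rfl | rfl | rfl | rfl | rfl | h | h
        · exact absurd rfl hdr''
        · exact absurd (fa r hr ra rd rb).2 nrr'
        · exact absurd (fb r hr rb ra rc).2 nrr'
        · exact absurd (fc r hr rc rb re).2 nrr'
        · exact absurd (fe r hr re rc hrs).2 nrr'
        · exact absurd h hrr'
        · exact h
      subst hr''
      have fr := full r hr d hd r' hs rd hrs sd.symm (fun h => ndr h.symm) nrr'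
      refine k6_case7 G x c e r' r d a b ?_ ?_ ?_ ?_ ?_ ?_ p hp
      all_goals clear hmem full F1 F2 F3 F4 hcom hsplit h4 hv5 hnb hdc hNmem hp p h5 hδ hchi hN7 hN5 hNcard hxd
      · simp; grind
      · simp; grind
      · simp; grind
      · simp; grind
      · simp; grind
      · grind
  obtain ⟨r, s, hrs, hRS⟩ : ∃ r s, r ≠ s ∧ N \ {d, a, b, c, e} = {r, s} := by
    apply Finset.card_eq_two.1
    have hsub : ({d, a, b, c, e} : Finset V) ⊆ N := by
      intro t ht
      simp at ht
      rcases ht with rfl | rfl | rfl | rfl | rfl <;> assumption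
    have hc5 : ({d, a, b, c, e} : Finset V).card = 5 := by
      have := hbd.ne; have := hac.ne; have := hbe.ne
      rw [Finset.card_insert_of_notMem, Finset.card_insert_of_notMem,
        Finset.card_insert_of_notMem, Finset.card_insert_of_notMem, Finset.card_singleton] <;>
        simp <;> grind
    rw [Finset.card_sdiff_of_subset hsub, hN7, hc5]
  have hmem : ∀ t, t ∈ N → t = d ∨ t = a ∨ t = b ∨ t = c ∨ t = e ∨ t = r ∨ t = s := by
    intro t ht
    have := Finset.ext_iff.1 hRS t
    simp at this
    tauto
  have hr := (Finset.ext_iff.1 hRS r)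
  have hs := (Finset.ext_iff.1 hRS s)
  simp at hr hs
  obtain ⟨d', hd', hdd', ndd', had'⟩ := F2 d hd a ha hda nda
  have had'' := had'.ne'
  have hd'' : d' = e ∨ d' = r ∨ d' = s := by
    rcases hmem d' hd' with rfl | rfl | rfl | rfl | rfl | h | h
    · exact absurd rfl hdd'
    · exact absurd rfl had''
    · exact absurd hbd.symm ndd'
    · exact absurd (fc d hd hdc' hdb hde).2 ndd'
    · exact Or.inl rfl
    · exact Or.inr (Or.inl h)
    · exact Or.inr (Or.inr h)
  rcases hd'' with rfl | rfl | rfl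
  · have fd := full d hd a ha d' he hda hde hae nda ndd'
    have fe := full d' he c hc d hd hec hde.symm hdc'.symm nec (fun h => ndd' h.symm)
    obtain ⟨hrN, rd, ra, rb, rc, re⟩ := hr
    obtain ⟨hsN, sd, sa, sb, sc, se⟩ := hs
    have hrsA : G.Adj r s := by
      by_contra nrs
      obtain ⟨t, ht, htr, nrt, hst⟩ := F2 r hrN s hsN hrs nrs
      have := hst.ne'
      rcases hmem t ht with rfl | rfl | rfl | rfl | rfl | h | h
      · exact nrt (fd r hrN rd ra re).2
      · exact nrt (fa r hrN ra rd rb).2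
      · exact nrt (fb r hrN rb ra rc).2
      · exact nrt (fc r hrN rc rb re).2
      · exact nrt (fe r hrN re rc rd).2
      · exact htr h
      · exact this h
    refine k6_case5 G x r s d b d' a c ?_ ?_ ?_ ?_ ?_ ?_ ?_ ?_ ?_
    all_goals clear hmem full F1 F2 F3 F4 hcom hsplit h4 hv5 hnb hdc hNmem hp p h5 hδ hchi hN7 hN5 hNcard hxd main hRS
    · simp; grind
    · simp; grind
    · simp; grind
    · simp; grind
    all_goals grind
  · exact main d' s hr.1 hs.1 hrs hr.2 hs.2 hmem ndd'
  · exact main d' r hs.1 hr.1 hrs.symm hs.2 hr.2 (fun t ht => by have := hmem t ht; tauto) ndd'
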